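/- arXiv:math/0205285 — 2 statements merged into one kernel-verified Lean document; each statement's English description precedes it below -/
import Mathlib

section
/- Let A be a Hopf algebra over ℂ. Left integrals are unique up to a scalar: if φ is a left integral on A and φ' : A → ℂ is any linear functional satisfying (id ⊗ φ')(Δ(a)) = φ'(a)·1 for all a ∈ A, then there exists c ∈ ℂ with φ' = c·φ. -/
/-!
STATEMENT 3: Let A be a Hopf algebra over ℂ.  Left integrals are unique up to a scalar:
if φ is a left integral on A and φ' : A → ℂ is any linear functional satisfying
(id ⊗ φ')(Δ(a)) = φ'(a)·1 for all a ∈ A, then there exists c ∈ ℂ with φ' = c·φ.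
-/

open scoped TensorProduct

/-- A left integral on a Hopf algebra `A` over `ℂ`: a nonzero linear functional `φ` with
`(id ⊗ φ)(Δ(a)) = φ(a)·1` for all `a`. -/
def IsLeftIntegral {A : Type*} [Semiring A] [HopfAlgebra ℂ A] (φ : A →ₗ[ℂ] ℂ) : Prop :=
  φ ≠ 0 ∧ ∀ a : A, TensorProduct.rid ℂ A (φ.lTensor A (Coalgebra.comul (R := ℂ) a)) = φ a • 1

open Coalgebra HopfAlgebra

namespace IntegralUniq

variable {A : Type*} [Semiring A] [HopfAlgebra ℂ A]
variable {M : Type*} [AddCommMonoid M] [Module ℂ M]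
variable {N : Type*} [AddCommMonoid N] [Module ℂ N]

/-- the antipode -/
noncomputable abbrev S : A →ₗ[ℂ] A := antipode ℂ

/-- Sweedler sum `∑ f a₁ a₂`. -/
noncomputable def sw (f : A → A → M) (a : A) : M :=
  ∑ i ∈ (ℛ ℂ a).index, f ((ℛ ℂ a).left i) ((ℛ ℂ a).right i)

lemma sw_comul (L : A ⊗[ℂ] A →ₗ[ℂ] M) (a : A) :
    L (comul a) = sw (fun x y => L (x ⊗ₜ y)) a := by
  conv_lhs => rw [← (ℛ ℂ a).eq, map_sum]
  rfl

lemma map_sw (L : M →ₗ[ℂ] N) (f : A → A → M) (a : A) :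
    L (sw f a) = sw (fun x y => L (f x y)) a := by
  simp [sw, map_sum]

lemma sw_mul (f : A → A → A) (a b : A) :
    sw f a * b = sw (fun x y => f x y * b) a := by
  simp [sw, Finset.sum_mul]

/-- bilinear function to map on tensors -/
noncomputable def toL (f : A → N → M) (h1 : ∀ v, IsLinearMap ℂ (fun u => f u v))
    (h2 : ∀ u, IsLinearMap ℂ (fun v => f u v)) : A ⊗[ℂ] N →ₗ[ℂ] M :=
  TensorProduct.lift (LinearMap.mk₂ ℂ f (fun a b v => (h1 v).map_add a b)
    (fun c a v => (h1 v).map_smul c a) (fun u a b => (h2 u).map_add a b)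
    (fun c u a => (h2 u).map_smul c a))

lemma toL_tmul (f : A → N → M) (h1) (h2) (u : A) (v : N) : toL f h1 h2 (u ⊗ₜ v) = f u v := rfl

lemma sw_coassoc (f : A → A → A → M) (h1 : ∀ v w, IsLinearMap ℂ (fun u => f u v w))
    (h2 : ∀ u w, IsLinearMap ℂ (fun v => f u v w))
    (h3 : ∀ u v, IsLinearMap ℂ (fun w => f u v w)) (a : A) :
    sw (fun x w => sw (fun u v => f u v w) x) a = sw (fun u y => sw (fun v w => f u v w) y) a := by
  have key := sum_tmul_tmul_eq (ℛ ℂ a) (fun i => ℛ ℂ ((ℛ ℂ a).left i))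
    (fun i => ℛ ℂ ((ℛ ℂ a).right i))
  let L : A ⊗[ℂ] (A ⊗[ℂ] A) →ₗ[ℂ] M :=
    toL (fun u t => toL (fun v w => f u v w) (h2 u) (h3 u) t)
      (fun t => by
        constructor
        · intro x y
          induction t with
          | zero => simp
          | tmul v w => simp only [toL_tmul]; exact (h1 v w).map_add x y
          | add s t hs ht => simp only [map_add, hs, ht]; abel
        · intro c x
          induction t with
          | zero => simp
          | tmul v w => simp only [toL_tmul]; exact (h1 v w).map_smul c x
          | add s t hs ht => simp only [map_add, hs, ht, smul_add])
      (fun u => LinearMap.isLinear _)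
  have := congrArg L key
  simpa [L, map_sum, toL_tmul, sw] using this

lemma sw_counit_left (f : A →ₗ[ℂ] M) (a : A) :
    sw (fun x y => counit (R := ℂ) x • f y) a = f a := by
  conv_rhs => rw [← sum_counit_smul (ℛ ℂ a)]
  simp [sw]

lemma sw_counit_right (f : A →ₗ[ℂ] M) (a : A) :
    sw (fun x y => counit (R := ℂ) y • f x) a = f a := by
  have := congrArg (TensorProduct.rid ℂ A) (lTensor_counit_comul (R := ℂ) a)
  rw [← (ℛ ℂ a).eq] at this
  simp only [map_sum, LinearMap.lTensor_tmul, TensorProduct.rid_tmul, one_smul] at this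
  conv_rhs => rw [← this]
  simp [sw]

lemma sw_S_mul (f : A →ₗ[ℂ] M) (a : A) :
    sw (fun x y => f (S x * y)) a = counit (R := ℂ) a • f 1 := by
  rw [← map_smul, ← sum_antipode_mul_eq_smul (ℛ ℂ a)]
  simp [sw]

lemma sw_mul_S (f : A →ₗ[ℂ] M) (a : A) :
    sw (fun x y => f (x * S y)) a = counit (R := ℂ) a • f 1 := by
  rw [← map_smul, ← sum_mul_antipode_eq_smul (ℛ ℂ a)]
  simp [sw]

lemma I1 (a : A) : sw (fun u v => (S u ⊗ₜ[ℂ] (1 : A)) * comul (R := ℂ) v) a = 1 ⊗ₜ a := by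
  have h1 : ∀ u v : A, (S u ⊗ₜ[ℂ] (1 : A)) * comul (R := ℂ) v =
      sw (fun v w => (S u * v) ⊗ₜ[ℂ] w) v := by
    intro u v
    have := sw_comul (LinearMap.mulLeft ℂ (S u ⊗ₜ[ℂ] (1 : A))) v
    simpa using this
  simp only [h1]
  rw [← sw_coassoc (fun u v w => (S u * v) ⊗ₜ[ℂ] w)]
  · have h2 : ∀ x w : A, sw (fun u v => (S u * v) ⊗ₜ[ℂ] w) x =
        counit (R := ℂ) x • ((1 : A) ⊗ₜ[ℂ] w) := fun x w =>
      sw_S_mul ((TensorProduct.mk ℂ A A).flip w) x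
    simp only [h2]
    exact sw_counit_left (TensorProduct.mk ℂ A A 1) a
  · intro v w; constructor <;> intros <;> simp [add_mul, TensorProduct.add_tmul, TensorProduct.smul_tmul']
  · intro v w; constructor <;> intros <;> simp [mul_add, TensorProduct.add_tmul, TensorProduct.smul_tmul']
  · intro v w; constructor <;> intros <;> simp [TensorProduct.tmul_add]

lemma I3 (a : A) : sw (fun u v => comul (R := ℂ) u * ((1 : A) ⊗ₜ[ℂ] S v)) a = a ⊗ₜ 1 := by
  have h1 : ∀ u v : A, comul (R := ℂ) u * ((1 : A) ⊗ₜ[ℂ] S v) =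
      sw (fun x y => x ⊗ₜ[ℂ] (y * S v)) u := by
    intro u v
    have := sw_comul (LinearMap.mulRight ℂ ((1 : A) ⊗ₜ[ℂ] S v)) u
    simpa using this
  simp only [h1]
  rw [sw_coassoc (fun u v w => u ⊗ₜ[ℂ] (v * S w))]
  · have h2 : ∀ u y : A, sw (fun v w => u ⊗ₜ[ℂ] (v * S w)) y =
        counit (R := ℂ) y • (u ⊗ₜ[ℂ] (1 : A)) := fun u y =>
      sw_mul_S (TensorProduct.mk ℂ A A u) y
    simp only [h2]
    exact sw_counit_right ((TensorProduct.mk ℂ A A).flip 1) a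
  · intro v w; constructor <;> intros <;> simp [TensorProduct.add_tmul, TensorProduct.smul_tmul']
  · intro v w; constructor <;> intros <;> simp [add_mul, TensorProduct.tmul_add]
  · intro v w; constructor <;> intros <;> simp [mul_add, TensorProduct.tmul_add]

lemma mul_sw' {B : Type*} [Semiring B] [Algebra ℂ B] (f : A → A → B) (b : B) (a : A) :
    b * sw f a = sw (fun x y => b * f x y) a := by
  simp [sw, Finset.mul_sum]

lemma sw_mul' {B : Type*} [Semiring B] [Algebra ℂ B] (f : A → A → B) (b : B) (a : A) :
    sw f a * b = sw (fun x y => f x y * b) a := by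
  simp [sw, Finset.sum_mul]

lemma I2 (b : A) : sw (fun u v => comul (R := ℂ) (S u) * (v ⊗ₜ[ℂ] (1 : A))) b = 1 ⊗ₜ S b := by
  have h1 : ∀ u v : A, comul (R := ℂ) (S u) * (v ⊗ₜ[ℂ] (1 : A)) =
      sw (fun v w => comul (R := ℂ) (S u * v) * ((1 : A) ⊗ₜ[ℂ] S w)) v := by
    intro u v
    rw [← I3, mul_sw']
    simp [mul_assoc]
  simp only [h1]
  rw [← sw_coassoc (fun u v w => comul (R := ℂ) (S u * v) * ((1 : A) ⊗ₜ[ℂ] S w))]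
  · have h2 : ∀ x w : A, sw (fun u v => comul (R := ℂ) (S u * v) * ((1 : A) ⊗ₜ[ℂ] S w)) x =
        counit (R := ℂ) x • ((1 : A) ⊗ₜ[ℂ] S w) := fun x w => by
      have := sw_S_mul (LinearMap.mulRight ℂ ((1 : A) ⊗ₜ[ℂ] S w) ∘ₗ comul (R := ℂ)) x
      simpa [← Algebra.TensorProduct.one_def] using this
    simp only [h2]
    exact sw_counit_left (TensorProduct.mk ℂ A A 1 ∘ₗ S) b
  · intro v w; constructor <;> intros <;> simp [-Bialgebra.comul_mul, add_mul]
  · intro v w; constructor <;> intros <;> simp [-Bialgebra.comul_mul, mul_add, add_mul]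
  · intro v w; constructor <;> intros <;> simp [-Bialgebra.comul_mul, mul_add, TensorProduct.tmul_add]

lemma comul_S (b : A) : comul (R := ℂ) (S b) = sw (fun u v => S v ⊗ₜ[ℂ] S u) b := by
  have h1 : ∀ u v : A, S v ⊗ₜ[ℂ] S u =
      sw (fun x y => comul (R := ℂ) (S x) * ((y * S v) ⊗ₜ[ℂ] (1 : A))) u := by
    intro u v
    have : S v ⊗ₜ[ℂ] S u = ((1 : A) ⊗ₜ[ℂ] S u) * (S v ⊗ₜ[ℂ] (1 : A)) := by simp
    rw [this, ← I2, sw_mul']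
    simp [mul_assoc]
  simp only [h1]
  rw [sw_coassoc (fun u v w => comul (R := ℂ) (S u) * ((v * S w) ⊗ₜ[ℂ] (1 : A)))]
  · have h2 : ∀ u y : A, sw (fun v w => comul (R := ℂ) (S u) * ((v * S w) ⊗ₜ[ℂ] (1 : A))) y =
        counit (R := ℂ) y • comul (R := ℂ) (S u) := fun u y => by
      have := sw_mul_S (LinearMap.mulLeft ℂ (comul (R := ℂ) (S u)) ∘ₗ
        (TensorProduct.mk ℂ A A).flip 1) y
      simpa [← Algebra.TensorProduct.one_def] using this
    simp only [h2]
    exact (sw_counit_right (comul ∘ₗ S) b).symm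
  · intro v w; constructor <;> intros <;> simp [add_mul]
  · intro v w; constructor <;> intros <;> simp [mul_add, add_mul, TensorProduct.add_tmul, ← TensorProduct.smul_tmul']
  · intro v w; constructor <;> intros <;> simp [mul_add, TensorProduct.add_tmul, ← TensorProduct.smul_tmul']

/-- slice `id ⊗ φ` -/
noncomputable def E (φ : A →ₗ[ℂ] ℂ) : A ⊗[ℂ] A →ₗ[ℂ] A :=
  (TensorProduct.rid ℂ A).toLinearMap ∘ₗ φ.lTensor A

/-- slice `ψ ⊗ id` -/
noncomputable def Esl (φ : A →ₗ[ℂ] ℂ) : A ⊗[ℂ] A →ₗ[ℂ] A :=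
  (TensorProduct.lid ℂ A).toLinearMap ∘ₗ φ.rTensor A

@[simp] lemma E_tmul (φ : A →ₗ[ℂ] ℂ) (x y : A) : E φ (x ⊗ₜ y) = φ y • x := by simp [E]
@[simp] lemma Esl_tmul (φ : A →ₗ[ℂ] ℂ) (x y : A) : Esl φ (x ⊗ₜ y) = φ x • y := by simp [Esl]

/-- left invariance -/
def LI (φ : A →ₗ[ℂ] ℂ) : Prop := ∀ a : A, E φ (comul a) = φ a • 1
/-- right invariance -/
def RI (φ : A →ₗ[ℂ] ℂ) : Prop := ∀ a : A, Esl φ (comul a) = φ a • 1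

lemma E_left (φ : A →ₗ[ℂ] ℂ) (x : A) (t : A ⊗[ℂ] A) :
    E φ ((x ⊗ₜ 1) * t) = x * E φ t := by
  induction t with
  | zero => simp
  | tmul v w => simp
  | add s t hs ht => simp [mul_add, hs, ht]

lemma E_right (φ : A →ₗ[ℂ] ℂ) (x : A) (t : A ⊗[ℂ] A) :
    E φ (t * (x ⊗ₜ 1)) = E φ t * x := by
  induction t with
  | zero => simp
  | tmul v w => simp
  | add s t hs ht => simp [add_mul, hs, ht]

lemma Esl_right (φ : A →ₗ[ℂ] ℂ) (x : A) (t : A ⊗[ℂ] A) :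
    Esl φ (t * (1 ⊗ₜ x)) = Esl φ t * x := by
  induction t with
  | zero => simp
  | tmul v w => simp
  | add s t hs ht => simp [add_mul, hs, ht]

lemma F1 {φ : A →ₗ[ℂ] ℂ} (h : LI φ) (a b : A) :
    E φ ((1 ⊗ₜ a) * comul b) = sw (fun u v => φ (v * b) • S u) a := by
  rw [← I1, sw_mul', map_sw]
  simp only [mul_assoc, E_left, ← Bialgebra.comul_mul, h _]
  simp

lemma F2 {φ : A →ₗ[ℂ] ℂ} (h : LI φ) (a b : A) :
    E φ (comul a * (1 ⊗ₜ S b)) = sw (fun u v => φ (a * S u) • v) b := by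
  rw [← I2, mul_sw', map_sw]
  simp only [← mul_assoc, E_right, ← Bialgebra.comul_mul, h _]
  simp

lemma F3 {ψ : A →ₗ[ℂ] ℂ} (h : RI ψ) (b a : A) :
    Esl ψ (comul b * (a ⊗ₜ 1)) = sw (fun u v => ψ (b * u) • S v) a := by
  rw [← I3, mul_sw', map_sw]
  simp only [← mul_assoc, Esl_right, ← Bialgebra.comul_mul, h _]
  simp

lemma slice (ψ φ : A →ₗ[ℂ] ℂ) (x : A) (t : A ⊗[ℂ] A) :
    ψ (E φ (t * (1 ⊗ₜ x))) = φ (Esl ψ t * x) := by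
  induction t with
  | zero => simp
  | tmul v w => simp [mul_comm]
  | add s t hs ht => simp [add_mul, hs, ht]

lemma slice' (ψ φ : A →ₗ[ℂ] ℂ) (x : A) (t : A ⊗[ℂ] A) :
    φ (Esl ψ (t * (x ⊗ₜ 1))) = ψ (E φ t * x) := by
  induction t with
  | zero => simp
  | tmul v w => simp [mul_comm]
  | add s t hs ht => simp [add_mul, hs, ht]

lemma FA {φ ψ : A →ₗ[ℂ] ℂ} (h : LI φ) (h' : RI ψ) (b : A) :
    ∃ k : A, ∀ a, ψ a * φ (S b) = φ (a * S k) := by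
  refine ⟨sw (fun u v => ψ v • u) b, fun a => ?_⟩
  have e := slice ψ φ (S b) (comul a)
  rw [h', F2 h, map_sw] at e
  simp only [smul_mul_assoc, one_mul, map_smul, smul_eq_mul] at e
  rw [← e, map_sw S, mul_sw', map_sw]
  simp [mul_comm]

lemma FB {φ ψ : A →ₗ[ℂ] ℂ} (h : LI φ) (h' : RI ψ) (d : A) :
    ∃ k : A, ∀ a, φ a * ψ (S d) = ψ (a * S k) := by
  refine ⟨sw (fun u v => φ (S (S u)) • v) d, fun a => ?_⟩
  have e := slice' ψ φ (S d) (comul a)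
  rw [h, F3 h', map_sw] at e
  simp only [smul_mul_assoc, one_mul, map_smul, smul_eq_mul] at e
  rw [← e]
  have e2 := sw_comul (toL (fun u v => ψ (a * u) * φ (S v))
    (fun v => by constructor <;> intros <;> simp [mul_add, add_mul, mul_assoc])
    (fun v => by constructor <;> intros <;> simp [mul_add, mul_left_comm])) (S d)
  simp only [toL_tmul] at e2
  rw [← e2, comul_S, map_sw, map_sw S, mul_sw', map_sw]
  simp [mul_comm, toL_tmul]

lemma FC {φ ψ : A →ₗ[ℂ] ℂ} (h : LI φ) (h' : LI ψ) (b y : A) :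
    ψ (E φ (comul b * (1 ⊗ₜ S y))) = ψ y * φ b := by
  rw [F2 h, map_sw]
  have e := h' y
  rw [sw_comul] at e
  have e2 := congrArg (fun z => φ (b * S z)) e
  simp only [map_sw S, mul_sw', map_sw φ] at e2
  simp at e2
  rw [← e2]
  simp [mul_comm]

lemma E_shift (φ φ' : A →ₗ[ℂ] ℂ) (c : ℂ) (w : A) (hw : ∀ a, c * φ' a = φ (a * w)) (x : A)
    (t : A ⊗[ℂ] A) : c • E φ' (t * (1 ⊗ₜ x)) = E φ (t * (1 ⊗ₜ (x * w))) := by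
  induction t with
  | zero => simp
  | tmul v u => simp [smul_smul, hw, mul_assoc]
  | add s t hs ht => simp [add_mul, hs, ht]

lemma core {φ ψ : A →ₗ[ℂ] ℂ} (h : LI φ) (h' : RI ψ) (hS : ∃ b, φ (S b) ≠ 0)
    (hS' : ∃ d, ψ (S d) ≠ 0) {φ' : A →ₗ[ℂ] ℂ} (hφ' : LI φ') : ∃ c : ℂ, φ' = c • φ := by
  obtain ⟨b, hb⟩ := hS
  obtain ⟨d, hd⟩ := hS'
  obtain ⟨k, hk⟩ := FA h h' b
  obtain ⟨g, hg⟩ := FB hφ' h' d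
  have hw : ∀ a, (φ (S b) * ψ (S d)) * φ' a = φ (a * S (k * g)) := by
    intro a
    rw [antipode_mul_antidistrib, ← mul_assoc, ← hk, ← hg]; ring
  have main : ∀ x y, (φ (S b) * ψ (S d)) * (φ y * φ' x) = φ (k * g * y) * φ x := by
    intro x y
    rw [← FC hφ' h x y, ← FC h h x, antipode_mul_antidistrib, ← E_shift φ φ' _ _ hw, map_smul,
      smul_eq_mul]
  refine ⟨φ (k * g * S b) / (φ (S b) * ψ (S d) * φ (S b)), LinearMap.ext fun x => ?_⟩
  have := main x (S b)
  simp only [LinearMap.smul_apply, smul_eq_mul]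
  field_simp
  linear_combination this

lemma exists_basis (V : Type*) [AddCommMonoid V] [Module ℂ V] :
    ∃ s : Set V, Nonempty (Module.Basis s ℂ V) := by
  let _ : AddCommGroup V := Module.addCommMonoidToAddCommGroup ℂ
  exact ⟨_, ⟨Module.Basis.ofVectorSpace ℂ V⟩⟩

lemma sep {x : A} (h : ∀ ω : A →ₗ[ℂ] ℂ, ω x = 0) : x = 0 := by
  obtain ⟨s, ⟨b⟩⟩ := exists_basis A
  apply b.ext_elem
  intro i
  simpa using h (b.coord i)

lemma exp_left (t : A ⊗[ℂ] A) : ∃ (s : Finset A) (c : A → (A →ₗ[ℂ] ℂ)),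
    t = ∑ j ∈ s, j ⊗ₜ Esl (c j) t := by
  classical
  obtain ⟨s, ⟨b⟩⟩ := exists_basis A
  have h := (TensorProduct.equivFinsuppOfBasisLeft b).symm_apply_apply t
  rw [TensorProduct.equivFinsuppOfBasisLeft_symm_apply] at h
  set f := TensorProduct.equivFinsuppOfBasisLeft b t with hf
  refine ⟨f.support.image b, fun j => if hj : ∃ i, b i = j then b.coord hj.choose else 0, ?_⟩
  rw [Finset.sum_image (fun _ _ _ _ e => b.injective e)]
  conv_lhs => rw [← h]
  refine Finset.sum_congr rfl fun i _ => ?_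
  have hj : ∃ i', b i' = b i := ⟨i, rfl⟩
  have : hj.choose = i := b.injective hj.choose_spec
  beta_reduce
  rw [dif_pos hj, this, hf, TensorProduct.equivFinsuppOfBasisLeft_apply]
  rfl

lemma slice'' (ω φ : A →ₗ[ℂ] ℂ) (a : A) (t : A ⊗[ℂ] A) :
    φ (a * Esl ω t) = ω (E φ ((1 ⊗ₜ a) * t)) := by
  induction t with
  | zero => simp
  | tmul v w => simp [mul_comm]
  | add s t hs ht => simp [mul_add, hs, ht]

lemma counit_slice (ω : A →ₗ[ℂ] ℂ) (x : A) : counit (R := ℂ) (Esl ω (comul x)) = ω x := by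
  have := slice'' ω counit 1 (comul x)
  rw [one_mul, ← Algebra.TensorProduct.one_def, one_mul] at this
  rw [this]
  simp [E]

lemma counit_slice' (ω : A →ₗ[ℂ] ℂ) (x : A) : counit (R := ℂ) (E ω (comul x)) = ω x := by
  have := slice'' counit ω 1 (comul x)
  rw [one_mul, ← Algebra.TensorProduct.one_def, one_mul] at this
  rw [← this]
  simp [Esl]

lemma rad_slice {φ : A →ₗ[ℂ] ℂ} (h : LI φ) {x : A} (hx : ∀ a, φ (a * x) = 0)
    (ω : A →ₗ[ℂ] ℂ) (a : A) : φ (a * Esl ω (comul x)) = 0 := by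
  rw [slice'', F1 h]
  simp [hx, sw]

lemma rad_counit {φ : A →ₗ[ℂ] ℂ} (h : LI φ) (h0 : φ ≠ 0) {x : A} (hx : ∀ a, φ (a * x) = 0) :
    counit (R := ℂ) x = 0 := by
  obtain ⟨a, ha⟩ : ∃ a, φ a ≠ 0 := by
    by_contra hc
    push Not at hc
    exact h0 (LinearMap.ext hc)
  have e := congrArg (fun z => φ (a * z)) (mul_antipode_rTensor_comul_apply (R := ℂ) x)
  obtain ⟨s, c, hs⟩ := exp_left (comul (R := ℂ) x)
  rw [hs] at e
  simp only [map_sum, LinearMap.rTensor_tmul, LinearMap.mul'_apply, Finset.mul_sum] at e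
  rw [Finset.sum_eq_zero] at e
  · rw [Algebra.algebraMap_eq_smul_one, mul_smul_comm, mul_one, map_smul, smul_eq_mul] at e
    exact (mul_eq_zero.mp e.symm).resolve_right ha
  · intro j _
    rw [← mul_assoc]
    exact rad_slice h hx _ _

lemma rad {φ : A →ₗ[ℂ] ℂ} (h : LI φ) (h0 : φ ≠ 0) {x : A} (hx : ∀ a, φ (a * x) = 0) :
    x = 0 := by
  refine sep fun ω => ?_
  rw [← counit_slice]
  exact rad_counit h h0 (rad_slice h hx ω)

lemma kerS_slice {φ : A →ₗ[ℂ] ℂ} (h : LI φ) (h0 : φ ≠ 0) {b : A} (hb : S b = 0)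
    (ω : A →ₗ[ℂ] ℂ) : S (E ω (comul b)) = 0 := by
  refine rad h h0 fun a => ?_
  have e := F2 h a b
  rw [hb] at e
  have e2 := congrArg ω e
  rw [map_sw] at e2
  rw [sw_comul, map_sw, mul_sw', map_sw]
  simp only [TensorProduct.tmul_zero, mul_zero, map_zero, map_smul, smul_eq_mul] at e2
  simp only [E_tmul, map_smul, mul_smul_comm, smul_eq_mul]
  rw [e2]
  simp [mul_comm]

lemma S_inj {φ : A →ₗ[ℂ] ℂ} (h : LI φ) (h0 : φ ≠ 0) {b : A} (hb : S b = 0) : b = 0 := by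
  refine sep fun ω => ?_
  rw [← counit_slice', ← counit_antipode, kerS_slice h h0 hb, map_zero]

lemma S_inj' {φ : A →ₗ[ℂ] ℂ} (h : LI φ) (h0 : φ ≠ 0) {x y : A} (hb : S x = S y) : x = y := by
  have e : x + (-1 : ℂ) • y = 0 := by
    apply S_inj h h0
    rw [map_add, map_smul, hb]
    nth_rewrite 1 [← one_smul ℂ (S y)]
    rw [← add_smul]; simp
  have e2 : (-1 : ℂ) • y + y = 0 := by
    nth_rewrite 2 [← one_smul ℂ y]
    rw [← add_smul]; simp
  calc x = x + ((-1 : ℂ) • y + y) := by rw [e2, add_zero]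
    _ = y := by rw [← add_assoc, e, zero_add]

lemma RI_comp_S {φ : A →ₗ[ℂ] ℂ} (h : LI φ) (h0 : φ ≠ 0) : RI (φ ∘ₗ S) := by
  intro a
  apply S_inj' h h0
  have e := h (S a)
  rw [comul_S, map_sw] at e
  rw [sw_comul, map_sw]
  simpa using e

lemma I2'' (a : A) : (1 : A) ⊗ₜ[ℂ] S (S (S a)) =
    sw (fun u v => comul (R := ℂ) (S (S (S u))) * (S (S v) ⊗ₜ[ℂ] (1 : A))) a := by
  have lin : ∃ L : A ⊗[ℂ] A →ₗ[ℂ] A ⊗[ℂ] A, ∀ u v,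
      L (u ⊗ₜ v) = comul (R := ℂ) (S u) * (v ⊗ₜ[ℂ] (1 : A)) :=
    ⟨toL (fun u v => comul (R := ℂ) (S u) * (v ⊗ₜ[ℂ] (1 : A)))
      (fun v => by constructor <;> intros <;> simp [add_mul])
      (fun v => by constructor <;> intros <;>
                    simp [mul_add, TensorProduct.add_tmul, ← TensorProduct.smul_tmul']),
      fun u v => rfl⟩
  obtain ⟨L, hL⟩ := lin
  rw [← I2]
  simp only [← hL]
  rw [← sw_comul L, comul_S, map_sw]
  have e : ∀ u v : A, L (S v ⊗ₜ S u) =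
      (L ∘ₗ (TensorProduct.comm ℂ A A).toLinearMap ∘ₗ TensorProduct.map S S) (u ⊗ₜ v) := by
    intro u v; simp
  simp only [e]
  rw [← sw_comul, comul_S, map_sw]

/-- the twisted functional `b ↦ φ (a₂ b S³(a₁))` -/
noncomputable def tw (φ : A →ₗ[ℂ] ℂ) (a : A) : A →ₗ[ℂ] ℂ :=
  sw (fun u w => φ ∘ₗ LinearMap.mulLeft ℂ w ∘ₗ LinearMap.mulRight ℂ (S (S (S u)))) a

lemma tw_apply (φ : A →ₗ[ℂ] ℂ) (a b : A) :
    tw φ a b = sw (fun u w => φ (w * (b * S (S (S u))))) a := by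
  simp [tw, sw]

lemma E_tw (φ : A →ₗ[ℂ] ℂ) (a : A) (t : A ⊗[ℂ] A) :
    E (tw φ a) t = sw (fun u w => E φ ((1 ⊗ₜ w) * (t * (1 ⊗ₜ S (S (S u)))))) a := by
  induction t with
  | zero => simp [sw]
  | tmul x y => simp [tw_apply, sw, Finset.sum_smul]
  | add s t hs ht => 
    rw [map_add, hs, ht]
    simp [sw, add_mul, mul_add, Finset.sum_add_distrib]

lemma LI_tw {φ : A →ₗ[ℂ] ℂ} (h : LI φ) (a : A) : LI (tw φ a) := by
  intro b
  rw [E_tw, tw_apply]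
  have h1 : ∀ x w : A, E φ ((1 ⊗ₜ w) * (comul (R := ℂ) b * (1 ⊗ₜ S (S (S x))))) =
      sw (fun u v => E φ ((1 ⊗ₜ w) * comul (R := ℂ) (b * S (S (S u)))) * S (S v)) x := by
    intro x w
    rw [I2'', mul_sw', mul_sw', map_sw]
    simp only [Bialgebra.comul_mul, ← mul_assoc, E_right]
  simp only [h1]
  rw [sw_coassoc (fun u v w => E φ ((1 ⊗ₜ w) * comul (R := ℂ) (b * S (S (S u)))) * S (S v))]
  · have h2 : ∀ u y : A,
        sw (fun v w => E φ ((1 ⊗ₜ w) * comul (R := ℂ) (b * S (S (S u)))) * S (S v)) y =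
          φ (y * (b * S (S (S u)))) • (1 : A) := by
      intro u y
      simp only [F1 h, sw_mul']
      rw [← sw_coassoc (fun v w z => φ (z * (b * S (S (S u)))) • S w * S (S v))]
      · have h3 : ∀ x z : A, sw (fun v w => φ (z * (b * S (S (S u)))) • S w * S (S v)) x =
            counit (R := ℂ) x • (φ (z * (b * S (S (S u)))) • (1 : A)) := by
          intro x z
          have := sw_S_mul (φ (z * (b * S (S (S u)))) • S) x
          simpa [antipode_mul_antidistrib] using this
        simp only [h3]
        exact sw_counit_left
          ((φ ∘ₗ LinearMap.mulRight ℂ (b * S (S (S u)))).smulRight (1 : A)) y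
      · intro v w; constructor <;> intros <;> simp [mul_add, smul_smul]
      · intro v w; constructor <;> intros <;> simp [add_mul, smul_smul, mul_comm]
      · intro v w; constructor <;> intros <;> simp [add_mul, add_smul, smul_smul]
    simp only [h2]
    simp [sw, Finset.sum_smul]
  · intro v w; constructor <;> intros <;> simp [-Bialgebra.comul_mul, mul_add, add_mul]
  · intro v w; constructor <;> intros <;> simp [-Bialgebra.comul_mul, mul_add]
  · intro v w; constructor <;> intros <;> simp [-Bialgebra.comul_mul, TensorProduct.tmul_add, add_mul]

lemma tw_ne {φ : A →ₗ[ℂ] ℂ} (a : A) (ha : φ a ≠ 0) : ∃ x y : A, tw φ x (S (S y)) ≠ 0 := by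
  by_contra hc
  push Not at hc
  apply ha
  have e : sw (fun u y => tw φ y (S (S u))) a = 0 := by simp [sw, hc]
  simp only [tw_apply] at e
  rw [← sw_coassoc (fun u v w => φ (w * (S (S u) * S (S (S v)))))] at e
  · have h2 : ∀ x w : A, sw (fun u v => φ (w * (S (S u) * S (S (S v))))) x =
        counit (R := ℂ) x • φ w := by
      intro x w
      have := sw_mul_S (φ ∘ₗ LinearMap.mulLeft ℂ w ∘ₗ S ∘ₗ S) x
      simpa [antipode_mul_antidistrib] using this
    simp only [h2] at e
    rwa [sw_counit_left] at e
  · intro v w; constructor <;> intros <;> simp [mul_add, add_mul]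
  · intro v w; constructor <;> intros <;> simp [mul_add]
  · intro v w; constructor <;> intros <;> simp [add_mul]

end IntegralUniq

open IntegralUniq in
theorem leftIntegral_unique_up_to_scalar
    {A : Type*} [Semiring A] [HopfAlgebra ℂ A]
    (φ : A →ₗ[ℂ] ℂ) (hφ : IsLeftIntegral φ)
    (φ' : A →ₗ[ℂ] ℂ)
    (hφ' : ∀ a : A,
      TensorProduct.rid ℂ A (φ'.lTensor A (Coalgebra.comul (R := ℂ) a)) = φ' a • 1) :
    ∃ c : ℂ, φ' = c • φ := by
  obtain ⟨h0, hL⟩ := hφ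
  have hL1 : LI φ := hL
  have hL2 : LI φ' := hφ'
  obtain ⟨a, ha⟩ : ∃ a, φ a ≠ 0 := by
    by_contra hc
    push Not at hc
    exact h0 (LinearMap.ext hc)
  obtain ⟨x, y, hxy⟩ := tw_ne a ha
  have hl := LI_tw hL1 x
  have hl0 : tw φ x ≠ 0 := fun e => hxy (by rw [e]; rfl)
  have hr := RI_comp_S hl hl0
  obtain ⟨c, hc⟩ := core hl hr ⟨S y, hxy⟩ ⟨y, hxy⟩ hL1
  obtain ⟨c', hc'⟩ := core hl hr ⟨S y, hxy⟩ ⟨y, hxy⟩ hL2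
  have hc0 : c ≠ 0 := by
    rintro rfl
    exact h0 (by rw [hc, zero_smul])
  refine ⟨c' / c, ?_⟩
  rw [hc, hc', smul_smul, div_mul_cancel₀ _ hc0]
end

section
/- Let A be a Hopf algebra over ℂ with bijective antipode, and let φ be a left integral on A. Then φ is faithful: for a ∈ A, if φ(b·a) = 0 for all b ∈ A then a = 0, and if φ(a·b) = 0 for all b ∈ A then a = 0. -/
/-!
STATEMENT 4: Let A be a Hopf algebra over ℂ with bijective antipode S, and let φ be a
left integral on A.  Then φ is faithful: for a ∈ A, if φ(b·a) = 0 for all b ∈ A then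
a = 0, and if φ(a·b) = 0 for all b ∈ A then a = 0.
-/

open scoped TensorProduct

open Coalgebra HopfAlgebra in
/-- Strong left invariance: `S(b₁) φ(b₂ a) = a₁ φ(b a₂)`. -/
lemma strong_inv {A : Type*} [Semiring A] [HopfAlgebra ℂ A]
    (φ : A →ₗ[ℂ] ℂ) (hφ : IsLeftIntegral φ) {a b : A} {ι κ : Type*}
    (s : Coalgebra.Repr ℂ a ι) (r : Coalgebra.Repr ℂ b κ) :
    ∑ i ∈ r.index, φ (r.right i * a) • antipode ℂ (r.left i) =
      ∑ k ∈ s.index, φ (b * s.right k) • s.left k := by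
  let G : A →ₗ[ℂ] A := ∑ k ∈ s.index,
    (φ ∘ₗ LinearMap.mulRight ℂ (s.right k)).smulRight (s.left k)
  have hG : ∀ z, G z = ∑ k ∈ s.index, φ (z * s.right k) • s.left k := by
    intro z; simp [G]
  have key : ∀ x : A, ∑ j ∈ (ℛ ℂ x).index, (ℛ ℂ x).left j * G ((ℛ ℂ x).right j)
      = φ (x * a) • 1 := by
    intro x
    rw [← hφ.2 (x * a), Bialgebra.comul_mul, ← s.eq, ← (ℛ ℂ x).eq, Finset.sum_mul_sum]
    simp [hG, Finset.mul_sum]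
  let F : A ⊗[ℂ] (A ⊗[ℂ] A) →ₗ[ℂ] A :=
    LinearMap.mul' ℂ A ∘ₗ TensorProduct.map (antipode ℂ) (LinearMap.mul' ℂ A ∘ₗ G.lTensor A)
  have h := congrArg F (sum_tmul_tmul_eq r (fun i => ℛ ℂ (r.left i)) (fun i => ℛ ℂ (r.right i)))
  simp only [F, map_sum, LinearMap.comp_apply, TensorProduct.map_tmul, LinearMap.lTensor_tmul,
    LinearMap.mul'_apply] at h
  simp only [← Finset.mul_sum, key] at h
  simp only [← mul_assoc, ← Finset.sum_mul, sum_antipode_mul_eq_smul] at h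
  simp only [smul_mul_assoc, one_mul, mul_smul_comm, mul_one] at h
  rw [← h, ← hG]
  conv_rhs => rw [← sum_counit_smul r]
  simp only [map_sum, map_smul]

open Coalgebra in
/-- If a left coideal condition holds for slices, `Δ a` has a representation with right legs
killed by the functionals. -/
lemma exists_good_repr.{u, v} {A : Type u} [Semiring A] [HopfAlgebra ℂ A] (a : A) {β : Type v}
    (ψ : β → A →ₗ[ℂ] ℂ)
    (h : ∀ t, TensorProduct.rid ℂ A ((ψ t).lTensor A (Coalgebra.comul (R := ℂ) a)) = 0) :
    ∃ (ι : Type u) (r : Coalgebra.Repr ℂ a ι), ∀ i ∈ r.index, ∀ t, ψ t (r.right i) = 0 := by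
  let _ : AddCommGroup A := Module.addCommMonoidToAddCommGroup ℂ
  let e := Module.Basis.ofVectorSpace ℂ A
  obtain ⟨c, hc⟩ := TensorProduct.eq_repr_basis_left e (Coalgebra.comul (R := ℂ) a)
  refine ⟨_, ⟨c.support, e, c, hc⟩, ?_⟩
  intro i _ t
  have h2 := h t
  rw [← hc] at h2
  simp only [Finsupp.sum, map_sum, LinearMap.lTensor_tmul, TensorProduct.rid_tmul] at h2
  have h3 := linearIndependent_iff'.1 e.linearIndependent c.support (fun i => ψ t (c i)) h2 i
  by_cases hi : i ∈ c.support
  · exact h3 hi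
  · simp [Finsupp.notMem_support_iff.1 hi]

lemma slice_repr {A : Type*} [Semiring A] [HopfAlgebra ℂ A] {a : A} {ι : Type*}
    (r : Coalgebra.Repr ℂ a ι) (ψ : A →ₗ[ℂ] ℂ) :
    TensorProduct.rid ℂ A (ψ.lTensor A (Coalgebra.comul (R := ℂ) a)) =
      ∑ i ∈ r.index, ψ (r.right i) • r.left i := by
  simp [← r.eq]

lemma eq_zero_of_counit {A : Type*} [Semiring A] [HopfAlgebra ℂ A] {a : A} {ι : Type*}
    (r : Coalgebra.Repr ℂ a ι)
    (h : ∀ i ∈ r.index, Coalgebra.counit (R := ℂ) (r.right i) = 0) : a = 0 := by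
  have h1 := slice_repr r (Coalgebra.counit (R := ℂ))
  rw [Coalgebra.lTensor_counit_comul, TensorProduct.rid_tmul, one_smul] at h1
  rw [h1]
  exact Finset.sum_eq_zero fun i hi => by rw [h i hi, zero_smul]

open Coalgebra HopfAlgebra in
theorem leftIntegral_faithful
    {A : Type*} [Semiring A] [HopfAlgebra ℂ A]
    (hS : Function.Bijective (HopfAlgebra.antipode (R := ℂ) (A := A)))
    (φ : A →ₗ[ℂ] ℂ) (hφ : IsLeftIntegral φ) (a : A) :
    ((∀ b : A, φ (b * a) = 0) → a = 0) ∧ ((∀ b : A, φ (a * b) = 0) → a = 0) := by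
  obtain ⟨y, hy⟩ : ∃ y, φ y ≠ 0 := by
    by_contra! hc
    exact hφ.1 (LinearMap.ext hc)
  constructor
  · have rep : ∀ a : A, (∀ b : A, φ (b * a) = 0) → ∃ (ι : Type _) (r : Coalgebra.Repr ℂ a ι),
        ∀ i ∈ r.index, ∀ b, φ (b * r.right i) = 0 := by
      intro a ha
      refine exists_good_repr a (fun b => φ ∘ₗ LinearMap.mulLeft ℂ b) fun b => ?_
      rw [slice_repr (ℛ ℂ a)]
      have := strong_inv φ hφ (ℛ ℂ a) (ℛ ℂ b)
      simp only [LinearMap.comp_apply, LinearMap.mulLeft_apply]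
      rw [← this]
      simp [ha]
    have cou : ∀ a : A, (∀ b : A, φ (b * a) = 0) → counit (R := ℂ) a = 0 := by
      intro a ha
      obtain ⟨ι, r, hr⟩ := rep a ha
      have h1 := congrArg (fun x => φ (y * x)) (sum_antipode_mul_eq_smul r)
      simp only [Finset.mul_sum, map_sum, ← mul_assoc, mul_smul_comm, mul_one, map_smul,
        smul_eq_mul] at h1
      rw [Finset.sum_eq_zero fun i hi => hr i hi _] at h1
      exact (mul_eq_zero.1 h1.symm).resolve_right hy
    intro ha
    obtain ⟨ι, r, hr⟩ := rep a ha
    exact eq_zero_of_counit r fun i hi => cou _ (hr i hi)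
  · have rep : ∀ a : A, (∀ b : A, φ (a * b) = 0) → ∃ (ι : Type _) (r : Coalgebra.Repr ℂ a ι),
        ∀ i ∈ r.index, ∀ b, φ (r.right i * b) = 0 := by
      intro a ha
      refine exists_good_repr a (fun b => φ ∘ₗ LinearMap.mulRight ℂ b) fun b => ?_
      rw [slice_repr (ℛ ℂ a)]
      have := strong_inv φ hφ (ℛ ℂ b) (ℛ ℂ a)
      apply hS.1
      simp only [LinearMap.comp_apply, LinearMap.mulRight_apply, map_sum, map_smul, map_zero]
      rw [this]
      simp [ha]
    have cou : ∀ a : A, (∀ b : A, φ (a * b) = 0) → counit (R := ℂ) a = 0 := by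
      intro a ha
      obtain ⟨ι, r, hr⟩ := rep a ha
      choose T hT using hS.2
      have h0 : ∑ i ∈ r.index, r.right i * T (r.left i) = counit (R := ℂ) a • (1 : A) := by
        apply hS.1
        rw [map_smul, antipode_one, ← sum_mul_antipode_eq_smul r, map_sum]
        simp only [antipode_mul_antidistrib, hT]
      have h1 := congrArg (fun x => φ (x * y)) h0
      simp only [Finset.sum_mul, map_sum, mul_assoc, smul_mul_assoc, one_mul, map_smul,
        smul_eq_mul] at h1
      rw [Finset.sum_eq_zero fun i hi => hr i hi _] at h1
      exact (mul_eq_zero.1 h1.symm).resolve_right hy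
    intro ha
    obtain ⟨ι, r, hr⟩ := rep a ha
    exact eq_zero_of_counit r fun i hi => cou _ (hr i hi)
end
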